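/- Let n ≥ 5 and let P : Fin n → ℝ² be a configuration of n labeled points (injective, in general position). Let a, b, c be pairwise distinct indices with χ_P(a,b,c) = +1. Then {a,b,c} is an inner important triangle of P (that is, {a,b,c} is the extreme set of some configuration Q on Fin n with the same radial system as P, and {a,b,c} is not the extreme set of P) if and only if the following three conditions hold: (1) no point P x with x ∉ {a,b,c} lies in the closed triangle with vertices P a, P b, P c; (2) every index x ∉ {a,b,c} lies in exactly one of the three sets P_a := {x | χ_P(b,a,x) = +1 ∧ χ_P(c,a,x) = −1}, P_b := {x | χ_P(c,b,x) = +1 ∧ χ_P(a,b,x) = −1}, P_c := {x | χ_P(a,c,x) = +1 ∧ χ_P(b,c,x) = −1}; and (3) for any two distinct indices v, w ∈ P_a the line through P v and P w intersects the closed segment [P b, P c], for any two distinct v, w ∈ P_b the line through P v and P w intersects [P c, P a], and for any two distinct v, w ∈ P_c the line through P v and P w intersects [P a, P b]. -/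

import Mathlib

noncomputable def det2 (v w : ℝ × ℝ) : ℝ := v.1 * w.2 - v.2 * w.1

noncomputable def chi {α : Type*} (P : α → ℝ × ℝ) (i j k : α) : ℝ :=
  Real.sign (det2 (P j - P i) (P k - P i))

def GenPos {α : Type*} (P : α → ℝ × ℝ) : Prop :=
  ∀ i j k : α, i ≠ j → i ≠ k → j ≠ k → chi P i j k ≠ 0

def Ccw {α : Type*} (P : α → ℝ × ℝ) (i j k l : α) : Prop :=
  (chi P i j k = 1 ∧ chi P i k l = 1) ∨
  (chi P i k l = 1 ∧ chi P i l j = 1) ∨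
  (chi P i l j = 1 ∧ chi P i j k = 1)

def Admissible {α : Type*} (i j k l : α) : Prop :=
  i ≠ j ∧ i ≠ k ∧ i ≠ l ∧ j ≠ k ∧ j ≠ l ∧ k ≠ l

def SameRadial {α : Type*} (P Q : α → ℝ × ℝ) : Prop :=
  ∀ i j k l : α, Admissible i j k l → (Ccw P i j k l ↔ Ccw Q i j k l)

def SameUndirected {α : Type*} (P Q : α → ℝ × ℝ) : Prop :=
  ∀ i : α, (∀ j k l : α, Admissible i j k l → (Ccw Q i j k l ↔ Ccw P i j k l)) ∨
           (∀ j k l : α, Admissible i j k l → (Ccw Q i j k l ↔ Ccw P i l k j))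

def ExtremeSet {α : Type*} (P : α → ℝ × ℝ) : Set α :=
  {i | P i ∉ convexHull ℝ (P '' {j | j ≠ i})}

def Important {n : ℕ} (P₀ : Fin n → ℝ × ℝ) (H : Set (Fin n)) : Prop :=
  ∃ Q : Fin n → ℝ × ℝ, Function.Injective Q ∧ GenPos Q ∧ SameRadial P₀ Q ∧ ExtremeSet Q = H

def lineThrough (p q : ℝ × ℝ) : Set (ℝ × ℝ) := {x | ∃ t : ℝ, x = p + t • (q - p)}

/-- Twice the signed area of the triangle `p q r`. -/
noncomputable def area (p q r : ℝ × ℝ) : ℝ := det2 (q - p) (r - p)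

lemma area_def (p q r : ℝ × ℝ) :
    area p q r = (q.1 - p.1) * (r.2 - p.2) - (q.2 - p.2) * (r.1 - p.1) := rfl

lemma area_rotate (p q r : ℝ × ℝ) : area q r p = area p q r := by
  simp only [area_def]; ring

lemma area_swap (p q r : ℝ × ℝ) : area p r q = -area p q r := by
  simp only [area_def]; ring

lemma area_exchange (p q r : ℝ × ℝ) : area q p r = -area p q r := by
  simp only [area_def]; ring

lemma area_left_self (p q : ℝ × ℝ) : area p q p = 0 := by
  simp only [area_def]; ring

lemma area_right_self (p q : ℝ × ℝ) : area p q q = 0 := by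
  simp only [area_def]; ring

lemma area_add (p q r x : ℝ × ℝ) : area p q x + area q r x + area r p x = area p q r := by
  simp only [area_def]; ring

lemma chi_eq_one_iff {α : Type*} (P : α → ℝ × ℝ) (i j k : α) :
    chi P i j k = 1 ↔ 0 < area (P i) (P j) (P k) := by
  unfold chi area
  rcases lt_trichotomy (det2 (P j - P i) (P k - P i)) 0 with h | h | h
  · rw [Real.sign_of_neg h]; constructor <;> intro h' <;> linarith
  · simp [h]
  · simp [Real.sign_of_pos h, h]

lemma chi_eq_neg_one_iff {α : Type*} (P : α → ℝ × ℝ) (i j k : α) :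
    chi P i j k = -1 ↔ area (P i) (P j) (P k) < 0 := by
  unfold chi area
  rcases lt_trichotomy (det2 (P j - P i) (P k - P i)) 0 with h | h | h
  · simp [Real.sign_of_neg h, h]
  · simp [h]
  · rw [Real.sign_of_pos h]; constructor <;> intro h' <;> linarith

lemma genPos_iff {α : Type*} (P : α → ℝ × ℝ) :
    GenPos P ↔ ∀ i j k : α, i ≠ j → i ≠ k → j ≠ k → area (P i) (P j) (P k) ≠ 0 := by
  simp only [GenPos, chi, area, ne_eq, Real.sign_eq_zero_iff]

lemma ccw_iff {α : Type*} (P : α → ℝ × ℝ) (i j k l : α) :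
    Ccw P i j k l ↔
      (0 < area (P i) (P j) (P k) ∧ 0 < area (P i) (P k) (P l)) ∨
      (0 < area (P i) (P k) (P l) ∧ 0 < area (P i) (P l) (P j)) ∨
      (0 < area (P i) (P l) (P j) ∧ 0 < area (P i) (P j) (P k)) := by
  simp only [Ccw, chi_eq_one_iff]

lemma GenPos.injective {n : ℕ} (hn : 3 ≤ n) {Q : Fin n → ℝ × ℝ} (hQ : GenPos Q) :
    Function.Injective Q := by
  intro i j hij
  by_contra h
  obtain ⟨k, hk⟩ : ∃ k, k ∉ ({i, j} : Finset (Fin n)) := by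
    by_contra! hall
    have h1 : (Finset.univ : Finset (Fin n)).card ≤ ({i, j} : Finset (Fin n)).card :=
      Finset.card_le_card fun x _ => hall x
    have h2 := Finset.card_le_two (a := i) (b := j)
    simp at h1
    omega
  simp only [Finset.mem_insert, Finset.mem_singleton, not_or] at hk
  refine (genPos_iff Q).1 hQ i j k h (Ne.symm hk.1) (Ne.symm hk.2) ?_
  rw [area_def, hij]; ring

/-! ### Extreme sets and triangles -/

lemma mem_convexHull_triple {p q r x : ℝ × ℝ} (h : x ∈ convexHull ℝ {p, q, r}) :
    ∃ u v w : ℝ, 0 ≤ u ∧ 0 ≤ v ∧ 0 ≤ w ∧ area q r x = u * area p q r ∧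
      area r p x = v * area p q r ∧ area p q x = w * area p q r := by
  rw [convexHull_insert (by simp), convexHull_pair] at h
  simp only [convexJoin_singleton_left, Set.mem_iUnion] at h
  obtain ⟨y, ⟨s, t, hs, ht, hst, rfl⟩, ⟨s', t', hs', ht', hst', rfl⟩⟩ := h
  obtain rfl : s = 1 - t := by linarith
  obtain rfl : s' = 1 - t' := by linarith
  refine ⟨1 - t', t' * (1 - t), t' * t, hs', by positivity, by positivity, ?_, ?_, ?_⟩ <;>
  · simp only [area_def, Prod.fst_add, Prod.snd_add, Prod.smul_fst, Prod.smul_snd, smul_eq_mul]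
    ring

lemma mem_convexHull_triple_of_area_mul_pos {p q r x : ℝ × ℝ}
    (h1 : 0 < area p q r * area q r x) (h2 : 0 < area p q r * area r p x)
    (h3 : 0 < area p q r * area p q x) : x ∈ convexHull ℝ {p, q, r} := by
  have hD : area p q r ≠ 0 := by intro h; simp [h] at h1
  have key : ∀ s : ℝ, 0 < area p q r * s → 0 ≤ s / area p q r := by
    intro s hs
    rw [div_eq_mul_inv, ← mul_inv_cancel_left₀ hD s, mul_right_comm, mul_assoc]
    have : 0 < (area p q r)⁻¹ * (area p q r)⁻¹ := mul_self_pos.2 (inv_ne_zero hD)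
    nlinarith [mul_pos hs this]
  have hsum := area_add p q r x
  have hp : p ∈ convexHull ℝ {p, q, r} := subset_convexHull _ _ (by simp)
  have hq : q ∈ convexHull ℝ {p, q, r} := subset_convexHull _ _ (by simp)
  have hr : r ∈ convexHull ℝ {p, q, r} := subset_convexHull _ _ (by simp)
  have hx : x = (area q r x / area p q r) • p + (area r p x / area p q r) • q +
      (area p q x / area p q r) • r := by
    ext <;> simp only [Prod.fst_add, Prod.snd_add, Prod.smul_fst, Prod.smul_snd, smul_eq_mul] <;>
    · field_simp
      simp only [area_def]
      ring
  have hmem := (convex_convexHull ℝ {p, q, r}).sum_mem (t := Finset.univ)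
    (w := ![area q r x / area p q r, area r p x / area p q r, area p q x / area p q r])
    (z := ![p, q, r]) (fun i _ => by fin_cases i <;> simp [key _ h1, key _ h2, key _ h3])
    (by
      simp only [Fin.sum_univ_three, Matrix.cons_val_zero, Matrix.cons_val_one, Matrix.cons_val]
      field_simp
      linarith)
    (fun i _ => by fin_cases i <;> simpa)
  simp only [Fin.sum_univ_three, Matrix.cons_val_zero, Matrix.cons_val_one,
    Matrix.cons_val] at hmem
  rwa [hx]

lemma range_subset_convexHull_extremeSet {n : ℕ} {P : Fin n → ℝ × ℝ} (hP : Function.Injective P)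
    (x : Fin n) : P x ∈ convexHull ℝ (P '' ExtremeSet P) := by
  have hfin : (Set.range P).Finite := Set.finite_range P
  have hKM := closure_convexHull_extremePoints (hfin.isCompact_convexHull ℝ)
    (convex_convexHull ℝ (Set.range P))
  have hsub : (convexHull ℝ (Set.range P)).extremePoints ℝ ⊆ P '' ExtremeSet P := by
    intro e he
    obtain ⟨i, rfl⟩ := extremePoints_convexHull_subset he
    refine ⟨i, fun hi => ?_, rfl⟩
    refine ((convex_convexHull ℝ _).mem_extremePoints_iff_mem_sdiff_convexHull_sdiff.1 he).2
      (convexHull_mono ?_ hi)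
    rintro _ ⟨j, hj, rfl⟩
    exact ⟨subset_convexHull _ _ ⟨j, rfl⟩, fun h => hj (hP h)⟩
  have : P x ∈ closure (convexHull ℝ ((convexHull ℝ (Set.range P)).extremePoints ℝ)) := by
    rw [hKM]; exact subset_convexHull _ _ ⟨x, rfl⟩
  have hcl : IsClosed (convexHull ℝ (P '' ExtremeSet P)) :=
    (Set.toFinite _).isClosed_convexHull ℝ
  exact closure_minimal (convexHull_mono hsub) hcl this

lemma area_mul_pos_of_extremeSet_eq {n : ℕ} {Q : Fin n → ℝ × ℝ} (hQ : Function.Injective Q)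
    (hgp : GenPos Q) {a b c : Fin n} (hab : a ≠ b) (hac : a ≠ c) (hbc : b ≠ c)
    (hext : ExtremeSet Q = {a, b, c}) {x : Fin n} (hxa : x ≠ a) (hxb : x ≠ b) (hxc : x ≠ c) :
    0 < area (Q a) (Q b) (Q c) * area (Q b) (Q c) (Q x) ∧
    0 < area (Q a) (Q b) (Q c) * area (Q c) (Q a) (Q x) ∧
    0 < area (Q a) (Q b) (Q c) * area (Q a) (Q b) (Q x) := by
  rw [genPos_iff] at hgp
  have hmem := range_subset_convexHull_extremeSet hQ x
  rw [hext, Set.image_insert_eq, Set.image_pair] at hmem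
  obtain ⟨u, v, w, hu, hv, hw, h1, h2, h3⟩ := mem_convexHull_triple hmem
  have key : ∀ (D s y : ℝ), D ≠ 0 → 0 ≤ s → y ≠ 0 → y = s * D → 0 < D * y := by
    rintro D s y hD hs hy rfl
    have : 0 < s := hs.lt_of_ne fun h => hy (by rw [← h, zero_mul])
    have := mul_self_pos.2 hD
    nlinarith [mul_pos ‹0 < s› this]
  exact ⟨key _ _ _ (hgp a b c hab hac hbc) hu (hgp b c x hbc hxb.symm hxc.symm) h1,
    key _ _ _ (hgp a b c hab hac hbc) hv (hgp c a x hac.symm hxc.symm hxa.symm) h2,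
    key _ _ _ (hgp a b c hab hac hbc) hw (hgp a b x hab hxa.symm hxb.symm) h3⟩

lemma mem_extremeSet_of_area_lt {α : Type*} {P : α → ℝ × ℝ} {a : α} (p q : ℝ × ℝ)
    (h : ∀ j, j ≠ a → area p q (P a) * area p q (P j) < area p q (P a) * area p q (P a)) :
    a ∈ ExtremeSet P := by
  intro hmem
  have hconv : Convex ℝ
      {y | area p q (P a) * area p q y < area p q (P a) * area p q (P a)} := by
    intro y hy z hz s t hs ht hst
    obtain rfl : s = 1 - t := by linarith
    have hlin : area p q ((1 - t) • y + t • z) = (1 - t) * area p q y + t * area p q z := by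
      simp only [area_def, Prod.fst_add, Prod.snd_add, Prod.smul_fst, Prod.smul_snd, smul_eq_mul]
      ring
    simp only [Set.mem_ofPred_eq, hlin] at *
    rcases hs.eq_or_lt with hs | hs
    · obtain rfl : t = 1 := by linarith
      simpa using hz
    · nlinarith [mul_pos hs (sub_pos.2 hy), mul_nonneg ht (sub_pos.2 hz).le]
  have hsub := convexHull_min (s := P '' {j | j ≠ a})
    (by rintro _ ⟨j, hj, rfl⟩; exact h j hj) hconv
  exact lt_irrefl (area p q (P a) * area p q (P a)) (hsub hmem)

lemma extremeSet_eq_of_area_mul_pos {α : Type*} {P : α → ℝ × ℝ} {a b c : α}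
    (hab : a ≠ b) (hac : a ≠ c) (hbc : b ≠ c) (hD : area (P a) (P b) (P c) ≠ 0)
    (h : ∀ x, x ≠ a → x ≠ b → x ≠ c →
      0 < area (P a) (P b) (P c) * area (P b) (P c) (P x) ∧
      0 < area (P a) (P b) (P c) * area (P c) (P a) (P x) ∧
      0 < area (P a) (P b) (P c) * area (P a) (P b) (P x)) :
    ExtremeSet P = {a, b, c} := by
  have hD2 := mul_self_pos.2 hD
  have h1 := area_rotate (P a) (P b) (P c)
  have h2 := area_rotate (P b) (P c) (P a)
  have hsum : ∀ x, area (P a) (P b) (P c) * area (P a) (P b) (P x) +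
      area (P a) (P b) (P c) * area (P b) (P c) (P x) +
      area (P a) (P b) (P c) * area (P c) (P a) (P x) =
      area (P a) (P b) (P c) * area (P a) (P b) (P c) := fun x => by
    rw [← area_add (P a) (P b) (P c) (P x)]; ring
  ext x
  simp only [Set.mem_insert_iff, Set.mem_singleton_iff]
  constructor
  · intro hx
    by_contra! hne
    obtain ⟨h1, h2, h3⟩ := h x hne.1 hne.2.1 hne.2.2
    refine hx (convexHull_mono ?_ (mem_convexHull_triple_of_area_mul_pos h1 h2 h3))
    rintro _ (rfl | rfl | rfl)
    · exact ⟨a, hne.1.symm, rfl⟩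
    · exact ⟨b, hne.2.1.symm, rfl⟩
    · exact ⟨c, hne.2.2.symm, rfl⟩
  · rintro (rfl | rfl | rfl)
    · refine mem_extremeSet_of_area_lt (P b) (P c) fun j hj => ?_
      rw [h1]
      by_cases hjb : j = b
      · rw [hjb, area_left_self]; simpa using hD2
      by_cases hjc : j = c
      · rw [hjc, area_right_self]; simpa using hD2
      linarith [h j hj hjb hjc, hsum j]
    · refine mem_extremeSet_of_area_lt (P c) (P a) fun j hj => ?_
      rw [h2, h1]
      by_cases hja : j = a
      · rw [hja, area_right_self]; simpa using hD2
      by_cases hjc : j = c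
      · rw [hjc, area_left_self]; simpa using hD2
      linarith [h j hja hj hjc, hsum j]
    · refine mem_extremeSet_of_area_lt (P a) (P b) fun j hj => ?_
      by_cases hja : j = a
      · rw [hja, area_left_self]; simpa using hD2
      by_cases hjb : j = b
      · rw [hjb, area_right_self]; simpa using hD2
      linarith [h j hja hjb hj, hsum j]

/-! ### Necessity -/

lemma lineThrough_inter_segment_nonempty {p q r s : ℝ × ℝ} (h : area p q r * area p q s < 0) :
    (lineThrough p q ∩ segment ℝ r s).Nonempty := by
  have hd : area p q r - area p q s ≠ 0 := by
    intro h0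
    rw [sub_eq_zero.1 h0] at h
    exact h.not_ge (mul_self_nonneg _)
  have hsq : 0 < (area p q r - area p q s) * (area p q r - area p q s) := mul_self_pos.2 hd
  have hs1 : area p q r / (area p q r - area p q s) =
      area p q r * (area p q r - area p q s) /
        ((area p q r - area p q s) * (area p q r - area p q s)) := by field_simp
  have hs2 : -area p q s / (area p q r - area p q s) =
      -area p q s * (area p q r - area p q s) /
        ((area p q r - area p q s) * (area p q r - area p q s)) := by field_simp
  set u := -area p q s / (area p q r - area p q s) with hu
  set v := area p q r / (area p q r - area p q s) with hv
  have hu0 : 0 ≤ u := by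
    rw [hs2]
    exact div_nonneg (by nlinarith [mul_self_nonneg (area p q s)]) hsq.le
  have hv0 : 0 ≤ v := by
    rw [hs1]
    exact div_nonneg (by nlinarith [mul_self_nonneg (area p q r)]) hsq.le
  have huv : u + v = 1 := by rw [hu, hv]; field_simp; ring
  have hzero : u * area p q r + v * area p q s = 0 := by rw [hu, hv]; field_simp; ring
  have hne : (q.1 - p.1) ^ 2 + (q.2 - p.2) ^ 2 ≠ 0 := by
    intro h0
    have h1 : q.1 - p.1 = 0 := by nlinarith [sq_nonneg (q.1 - p.1), sq_nonneg (q.2 - p.2)]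
    have h2 : q.2 - p.2 = 0 := by nlinarith [sq_nonneg (q.1 - p.1), sq_nonneg (q.2 - p.2)]
    simp [area_def, h1, h2] at h
  clear_value u v
  have hdet : area p q (u • r + v • s) = 0 := by
    rw [← hzero]
    obtain rfl : u = 1 - v := by linarith
    simp only [area_def, Prod.fst_add, Prod.snd_add, Prod.smul_fst, Prod.smul_snd, smul_eq_mul]
    ring
  refine ⟨u • r + v • s, ?_, u, v, hu0, hv0, huv, rfl⟩
  generalize u • r + v • s = y at hdet
  rw [area_def] at hdet
  refine ⟨((q.1 - p.1) * (y.1 - p.1) + (q.2 - p.2) * (y.2 - p.2)) /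
    ((q.1 - p.1) ^ 2 + (q.2 - p.2) ^ 2), ?_⟩
  ext <;> simp only [Prod.fst_add, Prod.snd_add, Prod.smul_fst, Prod.smul_snd, smul_eq_mul,
      Prod.fst_sub, Prod.snd_sub] <;> field_simp
  · linear_combination (-(q.2 - p.2)) * hdet
  · linear_combination (q.1 - p.1) * hdet

lemma area_mul_nonpos_of_lineThrough_inter_segment {p q r s : ℝ × ℝ}
    (h : (lineThrough p q ∩ segment ℝ r s).Nonempty) : area p q r * area p q s ≤ 0 := by
  obtain ⟨_, ⟨t, rfl⟩, u, v, hu, hv, huv, he⟩ := h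
  obtain rfl : u = 1 - v := by linarith
  have hz : (1 - v) * area p q r + v * area p q s = 0 := by
    have e1 := congrArg Prod.fst he
    have e2 := congrArg Prod.snd he
    simp only [Prod.fst_add, Prod.snd_add, Prod.smul_fst, Prod.smul_snd, smul_eq_mul,
      Prod.fst_sub, Prod.snd_sub] at e1 e2
    simp only [area_def]
    linear_combination (q.1 - p.1) * e2 - (q.2 - p.2) * e1
  by_contra! hpos
  rcases pos_and_pos_or_neg_and_neg_of_mul_pos hpos with ⟨h1, h2⟩ | ⟨h1, h2⟩
  · rcases hu.eq_or_lt with hu | hu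
    · nlinarith
    · nlinarith [mul_pos hu h1, mul_nonneg hv h2.le]
  · rcases hu.eq_or_lt with hu | hu
    · nlinarith
    · nlinarith [mul_pos hu (neg_pos.2 h1), mul_nonneg hv (neg_pos.2 h2).le]

/-- Two points on the left of the line `b c` in `P` but on its right in `Q` span a line that
separates `b` from `c`. -/
lemma area_mul_neg_of_sameRadial {α : Type*} {P Q : α → ℝ × ℝ} (hP : GenPos P)
    (hPQ : SameRadial P Q) {b c v w : α} (hbc : b ≠ c) (hbv : b ≠ v) (hbw : b ≠ w)
    (hcv : c ≠ v) (hcw : c ≠ w) (hvw : v ≠ w)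
    (hPv : 0 < area (P b) (P c) (P v)) (hPw : 0 < area (P b) (P c) (P w))
    (hQv : area (Q b) (Q c) (Q v) < 0) (hQw : area (Q b) (Q c) (Q w) < 0) :
    area (P v) (P w) (P b) * area (P v) (P w) (P c) < 0 := by
  rw [genPos_iff] at hP
  suffices H : ∀ v w, b ≠ v → b ≠ w → c ≠ v → c ≠ w → v ≠ w →
      0 < area (P b) (P c) (P v) → 0 < area (P b) (P c) (P w) →
      area (Q b) (Q c) (Q v) < 0 → area (Q b) (Q c) (Q w) < 0 →
      0 < area (P v) (P w) (P b) → ¬ 0 < area (P v) (P w) (P c) by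
    rcases (hP v w b hvw hbv.symm hbw.symm).lt_or_gt with h1 | h1 <;>
    rcases (hP v w c hvw hcv.symm hcw.symm).lt_or_gt with h2 | h2
    · refine absurd ?_ (H w v hbw hbv hcw hcv hvw.symm hPw hPv hQw hQv ?_)
      · rw [area_exchange]; linarith
      · rw [area_exchange]; linarith
    · exact mul_neg_of_neg_of_pos h1 h2
    · exact mul_neg_of_pos_of_neg h1 h2
    · exact absurd h2 (H v w hbv hbw hcv hcw hvw hPv hPw hQv hQw h1)
  clear hbv hbw hcv hcw hvw hPv hPw hQv hQw v w
  intro v w hbv hbw hcv hcw hvw hPv hPw hQv hQw h1 h2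
  have e1 := hPQ b c v w ⟨hbc, hbv, hbw, hcv, hcw, hvw⟩
  have e2 := hPQ c v w b ⟨hcv, hcw, hbc.symm, hvw, hbv.symm, hbw.symm⟩
  have e3 := hPQ v w b c ⟨hvw, hbv.symm, hcv.symm, hbw.symm, hcw.symm, hbc⟩
  simp only [ccw_iff] at e1 e2 e3
  have r1 : ∀ R : α → ℝ × ℝ, area (R b) (R w) (R c) = -area (R b) (R c) (R w) :=
    fun R => area_swap _ _ _
  have r2 : ∀ R : α → ℝ × ℝ, area (R c) (R w) (R b) = area (R b) (R c) (R w) :=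
    fun R => area_rotate _ _ _
  have r3 : ∀ R : α → ℝ × ℝ, area (R c) (R b) (R v) = -area (R b) (R c) (R v) :=
    fun R => area_exchange _ _ _
  have r4 : ∀ R : α → ℝ × ℝ, area (R v) (R w) (R b) = area (R b) (R v) (R w) :=
    fun R => area_rotate _ _ _
  have r5 : ∀ R : α → ℝ × ℝ, area (R v) (R b) (R c) = area (R b) (R c) (R v) :=
    fun R => (area_rotate _ _ _).symm
  have r6 : ∀ R : α → ℝ × ℝ, area (R v) (R c) (R w) = -area (R c) (R v) (R w) :=
    fun R => area_exchange _ _ _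
  have r7 : ∀ R : α → ℝ × ℝ, area (R v) (R w) (R c) = area (R c) (R v) (R w) :=
    fun R => area_rotate _ _ _
  simp only [r1, r2, r3, r4, r5, r6, r7] at e1 e2 e3 h1 h2
  grind

/-- How the orientations of a ccw triangle and a further point are constrained by the radial
system when the point lies inside the triangle in another realization. -/
lemma orientations_of_sameRadial {α : Type*} {P Q : α → ℝ × ℝ} (hP : GenPos P)
    (hPQ : SameRadial P Q) {a b c x : α} (hab : a ≠ b) (hac : a ≠ c) (hbc : b ≠ c)
    (hxa : x ≠ a) (hxb : x ≠ b) (hxc : x ≠ c) (hD : 0 < area (P a) (P b) (P c))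
    (h1 : 0 < area (Q a) (Q b) (Q c) * area (Q b) (Q c) (Q x))
    (h2 : 0 < area (Q a) (Q b) (Q c) * area (Q c) (Q a) (Q x))
    (h3 : 0 < area (Q a) (Q b) (Q c) * area (Q a) (Q b) (Q x)) :
    (0 < area (Q a) (Q b) (Q c) → 0 < area (P b) (P c) (P x) ∧ 0 < area (P c) (P a) (P x) ∧
      0 < area (P a) (P b) (P x)) ∧
    (area (Q a) (Q b) (Q c) < 0 →
      (0 < area (P b) (P c) (P x) ∧ area (P c) (P a) (P x) < 0 ∧ area (P a) (P b) (P x) < 0) ∨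
      (area (P b) (P c) (P x) < 0 ∧ 0 < area (P c) (P a) (P x) ∧ area (P a) (P b) (P x) < 0) ∨
      (area (P b) (P c) (P x) < 0 ∧ area (P c) (P a) (P x) < 0 ∧
        0 < area (P a) (P b) (P x))) := by
  rw [genPos_iff] at hP
  have n1 := hP b c x hbc hxb.symm hxc.symm
  have n2 := hP c a x hac.symm hxc.symm hxa.symm
  have n3 := hP a b x hab hxa.symm hxb.symm
  have hsum := area_add (P a) (P b) (P c) (P x)
  have e0 := hPQ x a b c ⟨hxa, hxb, hxc, hab, hac, hbc⟩
  have e1 := hPQ a b x c ⟨hab, hxa.symm, hac, hxb.symm, hbc, hxc⟩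
  have e2 := hPQ b c x a ⟨hbc, hxb.symm, hab.symm, hxc.symm, hac.symm, hxa⟩
  have e3 := hPQ c a x b ⟨hac.symm, hxc.symm, hbc.symm, hxa.symm, hab, hxb⟩
  simp only [ccw_iff] at e0 e1 e2 e3
  have r1 : ∀ (R : α → ℝ × ℝ) i j, area (R x) (R i) (R j) = area (R i) (R j) (R x) :=
    fun R i j => (area_rotate _ _ _).symm
  have r2 : ∀ (R : α → ℝ × ℝ) i j, area (R i) (R x) (R j) = -area (R i) (R j) (R x) :=
    fun R i j => area_swap _ _ _
  have r3 : ∀ R : α → ℝ × ℝ, area (R a) (R c) (R b) = -area (R a) (R b) (R c) :=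
    fun R => area_swap _ _ _
  have r4 : ∀ R : α → ℝ × ℝ, area (R b) (R a) (R c) = -area (R a) (R b) (R c) :=
    fun R => area_exchange _ _ _
  have r5 : ∀ R : α → ℝ × ℝ, area (R c) (R b) (R a) = -area (R a) (R b) (R c) :=
    fun R => by simp only [area_def]; ring
  have r6 : ∀ R : α → ℝ × ℝ, area (R a) (R c) (R x) = -area (R c) (R a) (R x) :=
    fun R => area_exchange _ _ _
  have r7 : ∀ R : α → ℝ × ℝ, area (R b) (R a) (R x) = -area (R a) (R b) (R x) :=
    fun R => area_exchange _ _ _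
  have r8 : ∀ R : α → ℝ × ℝ, area (R c) (R b) (R x) = -area (R b) (R c) (R x) :=
    fun R => area_exchange _ _ _
  simp only [r1, r2, r3, r4, r5, r6, r7, r8] at e0 e1 e2 e3
  refine ⟨fun hQ => ?_, fun hQ => ?_⟩
  · rw [mul_pos_iff_of_pos_left hQ] at h1 h2 h3
    clear hPQ hP r1 r2 r3 r4 r5 r6 r7 r8
    grind
  · have q1 := (neg_iff_neg_of_mul_pos h1).1 hQ
    have q2 := (neg_iff_neg_of_mul_pos h2).1 hQ
    have q3 := (neg_iff_neg_of_mul_pos h3).1 hQ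
    simp only [not_lt.2 q1.le, not_lt.2 q2.le, not_lt.2 q3.le, and_self, or_self,
      iff_false, not_or, not_and_or, not_lt] at e0
    rcases n1.lt_or_gt with n1 | n1 <;> rcases n2.lt_or_gt with n2 | n2 <;>
    rcases n3.lt_or_gt with n3 | n3 <;>
    first
    | exact Or.inl ⟨n1, n2, n3⟩
    | exact Or.inr (Or.inl ⟨n1, n2, n3⟩)
    | exact Or.inr (Or.inr ⟨n1, n2, n3⟩)
    | linarith
    | (obtain ⟨e | e, e' | e', e'' | e''⟩ := e0 <;> linarith)

/-! ### Sufficiency -/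

/-- Three positively spanning directions in clockwise order. -/
def direction : Fin 3 → ℝ × ℝ := ![(1, 0), (-1, -1), (0, 1)]

/-- The point at distance `s` along the ray `t`, displaced by `r` to the left of the ray. -/
def place (t : Fin 3) (s r : ℝ) : ℝ × ℝ := s • direction t + r • direction (t + 2)

lemma place_zero (s r : ℝ) : place 0 s r = (s, r) := by
  simp [place, direction]

lemma place_one (s r : ℝ) : place 1 s r = (r - s, -s) := by
  have h : (1 : Fin 3) + 2 = 0 := rfl
  simp [place, direction, h, sub_eq_neg_add]

lemma place_two (s r : ℝ) : place 2 s r = (-r, s - r) := by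
  have h : (2 : Fin 3) + 2 = 1 := rfl
  simp [place, direction, h, sub_eq_add_neg]

lemma fin_three_add : (0 : Fin 3) + 1 = 1 ∧ (1 : Fin 3) + 1 = 2 ∧ (2 : Fin 3) + 1 = 0 ∧
    (0 : Fin 3) + 2 = 2 ∧ (1 : Fin 3) + 2 = 0 ∧ (2 : Fin 3) + 2 = 1 := by decide

lemma area_place_self (t : Fin 3) (s₁ r₁ s₂ r₂ s₃ r₃ : ℝ) :
    area (place t s₁ r₁) (place t s₂ r₂) (place t s₃ r₃) =
      (s₂ - s₁) * (r₃ - r₁) - (r₂ - r₁) * (s₃ - s₁) := by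
  fin_cases t <;> simp [area_def, place_zero, place_one, place_two] <;> ring

lemma area_place_succ (t : Fin 3) (s₁ s₂ s₃ : ℝ) :
    area (place t s₁ 0) (place t s₂ 0) (place (t + 1) s₃ 0) = (s₁ - s₂) * s₃ := by
  fin_cases t <;> simp [area_def, place_zero, place_one, place_two, fin_three_add] <;> ring

lemma area_place_pred (t : Fin 3) (s₁ s₂ s₃ : ℝ) :
    area (place t s₁ 0) (place t s₂ 0) (place (t + 2) s₃ 0) = (s₂ - s₁) * s₃ := by
  fin_cases t <;> simp [area_def, place_zero, place_one, place_two, fin_three_add] <;> ring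

lemma area_place_transversal (t : Fin 3) (s₁ s₂ s₃ : ℝ) :
    area (place t s₁ 0) (place (t + 1) s₂ 0) (place (t + 2) s₃ 0) =
      -(s₁ * s₂ + s₂ * s₃ + s₃ * s₁) := by
  fin_cases t <;> simp [area_def, place_zero, place_one, place_two, fin_three_add] <;> ring

lemma continuous_area_place (t₁ t₂ t₃ : Fin 3) (s₁ r₁ s₂ r₂ s₃ r₃ : ℝ) :
    Continuous fun ε : ℝ =>
      area (place t₁ s₁ (ε * r₁)) (place t₂ s₂ (ε * r₂)) (place t₃ s₃ (ε * r₃)) := by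
  simp only [area_def, place]
  fun_prop

lemma area_mul_sq_eq_det (a b c x y z : ℝ × ℝ) :
    area a b c ^ 2 * area x y z =
      area b c x * (area c a y * area a b z - area a b y * area c a z) -
      area c a x * (area b c y * area a b z - area a b y * area b c z) +
      area a b x * (area b c y * area c a z - area c a y * area b c z) := by
  simp only [area_def]; ring

lemma area_pos_of_cones {a b c i j k : ℝ × ℝ} (hD : 0 < area a b c)
    (hi₁ : area a b i ≤ 0) (hi₂ : area c a i ≤ 0) (hj₁ : area b c j ≤ 0) (hj₂ : area a b j ≤ 0)
    (hk₁ : area c a k ≤ 0) (hk₂ : area b c k ≤ 0) : 0 < area i j k := by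
  have key := area_mul_sq_eq_det a b c i j k
  have ei : area b c i = area a b c - area a b i - area c a i := by
    linarith [area_add a b c i]
  have ej : area c a j = area a b c - area a b j - area b c j := by
    linarith [area_add a b c j]
  have ek : area a b k = area a b c - area b c k - area c a k := by
    linarith [area_add a b c k]
  rw [ei, ej, ek] at key
  refine pos_of_mul_pos_right (a := area a b c ^ 2) ?_ (sq_nonneg _)
  rw [key]
  obtain ⟨u₁, hu₁⟩ : ∃ u, u = -area a b i := ⟨_, rfl⟩
  obtain ⟨u₂, hu₂⟩ : ∃ u, u = -area c a i := ⟨_, rfl⟩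
  obtain ⟨v₁, hv₁⟩ : ∃ u, u = -area b c j := ⟨_, rfl⟩
  obtain ⟨v₂, hv₂⟩ : ∃ u, u = -area a b j := ⟨_, rfl⟩
  obtain ⟨w₁, hw₁⟩ : ∃ u, u = -area c a k := ⟨_, rfl⟩
  obtain ⟨w₂, hw₂⟩ : ∃ u, u = -area b c k := ⟨_, rfl⟩
  rw [← neg_nonneg] at hi₁ hi₂ hj₁ hj₂ hk₁ hk₂
  rw [← hu₁] at hi₁; rw [← hu₂] at hi₂; rw [← hv₁] at hj₁; rw [← hv₂] at hj₂
  rw [← hw₁] at hk₁; rw [← hw₂] at hk₂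
  rw [eq_neg_iff_add_eq_zero, add_comm, ← eq_neg_iff_add_eq_zero] at hu₁ hu₂ hv₁ hv₂ hw₁ hw₂
  rw [hu₁, hu₂, hv₁, hv₂, hw₁, hw₂]
  generalize area a b c = D at hD
  ring_nf
  positivity

lemma increments_pos {D x y dx dy : ℝ} (hD : 0 < D) (hx : 0 ≤ x) (hy : 0 ≤ y)
    (h₁ : 0 < dy * (D + x) - dx * y) (h₂ : dy * x - dx * (D + y) < 0) : 0 < dx ∧ 0 < dy := by
  have hdx : 0 < dx := by
    by_contra! h
    have hdy : dy < 0 := by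
      by_contra! h'
      nlinarith [mul_nonneg h' hx, mul_nonneg (neg_nonneg.2 h) (add_nonneg hD.le hy)]
    have e₁ : -dy * (D + x) < -dx * y := by linarith
    have e₂ : -dx * (D + y) < -dy * x := by linarith
    nlinarith [mul_pos (neg_pos.2 hdy) hD, mul_nonneg (neg_nonneg.2 h) hD.le]
  refine ⟨hdx, ?_⟩
  by_contra! h
  nlinarith [mul_nonneg hdx.le hy, mul_nonneg (neg_nonneg.2 h) (add_nonneg hD.le hx)]

/-- If the line through two points `i`, `j` of the cone opposite to `b c` at `a` separates `b`
from `c`, then it separates the cones at `b` and `c`, and the side on which each of them lies is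
determined by which of `i`, `j` is farther from the line `b c`. -/
lemma area_cone_of_separating {a b c i j : ℝ × ℝ} (hD : 0 < area a b c)
    (hi₁ : area a b i ≤ 0) (hi₂ : area c a i ≤ 0) (hj₁ : area a b j ≤ 0) (hj₂ : area c a j ≤ 0)
    (hsep : area i j b * area i j c < 0) :
    (∀ k, area b c k ≤ 0 → area a b k ≤ 0 → 0 < (area b c j - area b c i) * area i j k) ∧
    (∀ k, area c a k ≤ 0 → area b c k ≤ 0 → (area b c j - area b c i) * area i j k < 0) := by
  wlog h : 0 < area i j b generalizing i j
  · have hs₁ := area_exchange i j b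
    have hs₂ := area_exchange i j c
    have h0 : area i j b ≠ 0 := fun h0 => by simp [h0] at hsep
    have hlt := lt_of_le_of_ne (not_lt.1 h) h0
    obtain ⟨h₁, h₂⟩ := this hj₁ hj₂ hi₁ hi₂ (by rw [hs₁, hs₂]; linarith) (by linarith)
    refine ⟨fun k hk hk' => ?_, fun k hk hk' => ?_⟩
    · have := h₁ k hk hk'
      rw [area_exchange i j k] at this
      linarith
    · have := h₂ k hk hk'
      rw [area_exchange i j k] at this
      linarith
  have h' : area i j c < 0 := by
    by_contra! h'
    exact hsep.not_ge (mul_nonneg h.le h')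
  have ebi : area b c i = area a b c - area a b i - area c a i := by
    linarith [area_add a b c i]
  have ebj : area b c j = area a b c - area a b j - area c a j := by
    linarith [area_add a b c j]
  have eb : area a b c * area i j b =
      (area a b i - area a b j) * (area a b c + -area c a i) -
        (area c a i - area c a j) * -area a b i := by
    simp only [area_def]; ring
  have ec : area a b c * area i j c =
      (area a b i - area a b j) * -area c a i -
        (area c a i - area c a j) * (area a b c + -area a b i) := by
    simp only [area_def]; ring
  obtain ⟨hdx, hdy⟩ := increments_pos hD (neg_nonneg.2 hi₂) (neg_nonneg.2 hi₁)
    (eb ▸ mul_pos hD h) (ec ▸ mul_neg_of_pos_of_neg hD h')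
  have hinc : 0 < area b c j - area b c i := by linarith
  refine ⟨fun k hk hk' => mul_pos hinc ?_, fun k hk hk' => mul_neg_of_pos_of_neg hinc ?_⟩
  · have e : area a b c * area i j k = area a b c * area i j b +
        -area a b k * (area b c j - area b c i) + -area b c k * (area a b i - area a b j) := by
      simp only [area_def]; ring
    refine pos_of_mul_pos_right (a := area a b c) ?_ hD.le
    rw [e]
    have := mul_pos hD h
    have := mul_nonneg (neg_nonneg.2 hk') hinc.le
    have := mul_nonneg (neg_nonneg.2 hk) hdy.le
    linarith
  · have e : area a b c * area i j k = area a b c * area i j c -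
        -area b c k * (area c a i - area c a j) - -area c a k * (area b c j - area b c i) := by
      simp only [area_def]; ring
    refine neg_of_mul_neg_right (a := area a b c) ?_ hD.le
    rw [e]
    have := mul_neg_of_pos_of_neg hD h'
    have := mul_nonneg (neg_nonneg.2 hk) hinc.le
    have := mul_nonneg (neg_nonneg.2 hk') hdx.le
    linarith

/-- The triangle `T` is ccw, every point `x` lies in the closed cone opposite to the triangle at
the vertex `T (g x)`, and the line through two points of a cone separates the two other
vertices. -/
structure ConeDecomposition {α : Type*} (P : α → ℝ × ℝ) (T : Fin 3 → α) (g : α → Fin 3) :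
    Prop where
  pos : ∀ t, 0 < area (P (T t)) (P (T (t + 1))) (P (T (t + 2)))
  right : ∀ x, area (P (T (g x))) (P (T (g x + 1))) (P x) ≤ 0
  left : ∀ x, area (P (T (g x + 2))) (P (T (g x))) (P x) ≤ 0
  sep : ∀ i j, i ≠ j → g i = g j →
    area (P i) (P j) (P (T (g i + 1))) * area (P i) (P j) (P (T (g i + 2))) < 0

/-- The points `i`, `j`, `k` lie in three different classes. -/
def Transversal {α : Type*} (g : α → Fin 3) (i j k : α) : Prop :=
  g i ≠ g j ∧ g j ≠ g k ∧ g i ≠ g k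

/-- The distance from `x` to the opposite side of its cone, up to scaling. -/
noncomputable def depth {α : Type*} (P : α → ℝ × ℝ) (T : Fin 3 → α) (g : α → Fin 3) (x : α) : ℝ :=
  area (P (T (g x + 1))) (P (T (g x + 2))) (P x)

/-- The difference of the two cone coordinates of `x`. -/
noncomputable def skew {α : Type*} (P : α → ℝ × ℝ) (T : Fin 3 → α) (g : α → Fin 3) (x : α) : ℝ :=
  area (P (T (g x))) (P (T (g x + 1))) (P x) - area (P (T (g x + 2))) (P (T (g x))) (P x)

/-- Each cone is flattened onto a ray, with the vertex of the cone becoming the outermost point. -/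
noncomputable def inversion {α : Type*} (P : α → ℝ × ℝ) (T : Fin 3 → α) (g : α → Fin 3)
    (M ε : ℝ) (x : α) : ℝ × ℝ :=
  place (g x) (M - depth P T g x) (ε * skew P T g x)

/-- `P` and `Q` orient exactly the transversal triples differently. -/
def FlipsTransversal {α : Type*} (P Q : α → ℝ × ℝ) (g : α → Fin 3) (i j k : α) : Prop :=
  (Transversal g i j k → area (P i) (P j) (P k) * area (Q i) (Q j) (Q k) < 0) ∧
  (¬ Transversal g i j k → 0 < area (P i) (P j) (P k) * area (Q i) (Q j) (Q k))

lemma fin_three_add_add (t : Fin 3) :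
    t + 1 + 1 = t + 2 ∧ t + 1 + 2 = t ∧ t + 2 + 1 = t ∧ t + 2 + 2 = t + 1 := by
  decide +revert

lemma fin_three_cases (t u : Fin 3) : u = t ∨ u = t + 1 ∨ u = t + 2 := by
  decide +revert

lemma fin_three_eq_of_ne (p q r s : Fin 3) (h : p ≠ q ∧ q ≠ r ∧ p ≠ r) :
    (p ≠ r ∧ r ≠ s ∧ p ≠ s → ¬ (p ≠ s ∧ s ≠ q ∧ p ≠ q) ∧ s = q) ∧
    (¬ (p ≠ r ∧ r ≠ s ∧ p ≠ s) → (p ≠ s ∧ s ≠ q ∧ p ≠ q → r = s) ∧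
      (¬ (p ≠ s ∧ s ≠ q ∧ p ≠ q) → p = s)) := by
  fin_cases p <;> fin_cases q <;> fin_cases r <;> fin_cases s <;> simp_all

lemma fin_three_ne (t : Fin 3) : t ≠ t + 1 ∧ t ≠ t + 2 ∧ t + 1 ≠ t + 2 := by
  decide +revert

section

variable {α : Type*} {P Q : α → ℝ × ℝ} {T : Fin 3 → α} {g : α → Fin 3} {i j k l : α}

lemma FlipsTransversal.rotate (h : FlipsTransversal P Q g i j k) :
    FlipsTransversal P Q g j k i := by
  have : Transversal g j k i ↔ Transversal g i j k := by simp only [Transversal]; tauto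
  rwa [FlipsTransversal, this, area_rotate (P i), area_rotate (Q i)]

lemma FlipsTransversal.exchange (h : FlipsTransversal P Q g i j k) :
    FlipsTransversal P Q g j i k := by
  have : Transversal g j i k ↔ Transversal g i j k := by simp only [Transversal]; tauto
  rwa [FlipsTransversal, this, area_exchange, area_exchange (Q i), neg_mul_neg]

lemma Transversal.cases (h : Transversal g i j k) :
    (g j = g i + 1 ∧ g k = g i + 2) ∨ (g k = g i + 1 ∧ g j = g i + 2) := by
  unfold Transversal at h
  generalize g i = p, g j = q, g k = r at h
  decide +revert

namespace ConeDecomposition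

lemma area_succ (h : ConeDecomposition P T g) (hij : i ≠ j) (hg : g i = g j)
    (hk : g k = g i + 1) :
    0 < (depth P T g j - depth P T g i) * area (P i) (P j) (P k) := by
  have hr := h.right k
  have hl := h.left k
  rw [hk, (fin_three_add_add _).1] at hr
  rw [hk, (fin_three_add_add _).2.1] at hl
  have := (area_cone_of_separating (h.pos (g i)) (h.right i) (h.left i)
    (by have := h.right j; rwa [← hg] at this) (by have := h.left j; rwa [← hg] at this)
    (h.sep i j hij hg)).1 (P k) hr hl
  rwa [depth, depth, ← hg]

lemma area_pred (h : ConeDecomposition P T g) (hij : i ≠ j) (hg : g i = g j)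
    (hk : g k = g i + 2) :
    (depth P T g j - depth P T g i) * area (P i) (P j) (P k) < 0 := by
  have hr := h.right k
  have hl := h.left k
  rw [hk, (fin_three_add_add _).2.2.1] at hr
  rw [hk, (fin_three_add_add _).2.2.2] at hl
  have := (area_cone_of_separating (h.pos (g i)) (h.right i) (h.left i)
    (by have := h.right j; rwa [← hg] at this) (by have := h.left j; rwa [← hg] at this)
    (h.sep i j hij hg)).2 (P k) hr hl
  rwa [depth, depth, ← hg]

lemma area_transversal (h : ConeDecomposition P T g) (hj : g j = g i + 1) (hk : g k = g i + 2) :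
    0 < area (P i) (P j) (P k) := by
  have hjr := h.right j
  have hjl := h.left j
  have hkr := h.right k
  have hkl := h.left k
  rw [hj, (fin_three_add_add _).1] at hjr
  rw [hj, (fin_three_add_add _).2.1] at hjl
  rw [hk, (fin_three_add_add _).2.2.1] at hkr
  rw [hk, (fin_three_add_add _).2.2.2] at hkl
  exact area_pos_of_cones (h.pos (g i)) (h.right i) (h.left i) hjr hjl hkr hkl

lemma area_inversion_self (hij : g i = g j) (hik : g i = g k) (M ε : ℝ) :
    area (inversion P T g M ε i) (inversion P T g M ε j) (inversion P T g M ε k) =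
      2 * ε * area (P (T (g i))) (P (T (g i + 1))) (P (T (g i + 2))) *
        area (P i) (P j) (P k) := by
  simp only [inversion, ← hij, ← hik, area_place_self, depth, skew]
  simp only [area_def]
  ring

open Filter Topology in
lemma eventually_flipsTransversal (h : ConeDecomposition P T g) (hP : GenPos P) {M : ℝ}
    (hM : ∀ x, depth P T g x < M) (hij : i ≠ j) (hik : i ≠ k) (hjk : j ≠ k) :
    ∀ᶠ ε in 𝓝[>] (0 : ℝ), FlipsTransversal P (inversion P T g M ε) g i j k := by
  have hcont : ∀ i j k, Tendsto (fun ε => area (P i) (P j) (P k) *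
      area (inversion P T g M ε i) (inversion P T g M ε j) (inversion P T g M ε k))
      (𝓝[>] 0) (𝓝 (area (P i) (P j) (P k) * area (place (g i) (M - depth P T g i) 0)
        (place (g j) (M - depth P T g j) 0) (place (g k) (M - depth P T g k) 0))) := by
    intro i j k
    have := ((continuous_area_place (g i) (g j) (g k) (M - depth P T g i) (skew P T g i)
      (M - depth P T g j) (skew P T g j) (M - depth P T g k) (skew P T g k)).tendsto 0).const_mul
      (area (P i) (P j) (P k))
    simp only [zero_mul] at this
    exact this.mono_left nhdsWithin_le_nhds
  have hpos : ∀ x, 0 < M - depth P T g x := fun x => sub_pos.2 (hM x)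
  have two_equal : ∀ i j k, i ≠ j → i ≠ k → j ≠ k → g i = g j →
      ∀ᶠ ε in 𝓝[>] (0 : ℝ), FlipsTransversal P (inversion P T g M ε) g i j k := by
    intro i j k hij hik hjk hg
    have hnt : ¬ Transversal g i j k := fun ht => ht.1 hg
    suffices H : ∀ᶠ ε in 𝓝[>] (0 : ℝ), 0 < area (P i) (P j) (P k) *
        area (inversion P T g M ε i) (inversion P T g M ε j) (inversion P T g M ε k) from
      H.mono fun ε hε => ⟨fun ht => absurd ht hnt, fun _ => hε⟩
    rcases fin_three_cases (g i) (g k) with hk | hk | hk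
    · filter_upwards [self_mem_nhdsWithin] with ε hε
      rw [area_inversion_self hg hk.symm]
      have hε : 0 < ε := hε
      have := mul_self_pos.2 ((genPos_iff P).1 hP i j k hij hik hjk)
      have := mul_pos (mul_pos hε (h.pos (g i))) this
      linarith
    · refine (hcont i j k).eventually_const_lt ?_
      rw [← hg, hk, area_place_succ]
      have := mul_pos (h.area_succ hij hg hk) (hpos k)
      linarith
    · refine (hcont i j k).eventually_const_lt ?_
      rw [← hg, hk, area_place_pred]
      have := mul_pos_of_neg_of_neg (h.area_pred hij hg hk) (neg_neg_of_pos (hpos k))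
      linarith
  have all_distinct : ∀ i j k, g j = g i + 1 → g k = g i + 2 →
      ∀ᶠ ε in 𝓝[>] (0 : ℝ), FlipsTransversal P (inversion P T g M ε) g i j k := by
    intro i j k hj hk
    obtain ⟨h₁, h₂, h₃⟩ := fin_three_ne (g i)
    have ht : Transversal g i j k := by
      rw [Transversal, hj, hk]; exact ⟨h₁, h₃, h₂⟩
    refine Eventually.mono ((hcont i j k).eventually_lt_const (u := 0) ?_)
      fun ε hε => ⟨fun _ => hε, fun hnt => absurd ht hnt⟩
    rw [hj, hk, area_place_transversal]
    refine mul_neg_of_pos_of_neg (h.area_transversal hj hk) ?_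
    have := mul_pos (hpos i) (hpos j)
    have := mul_pos (hpos j) (hpos k)
    have := mul_pos (hpos k) (hpos i)
    linarith
  by_cases h₁ : g i = g j
  · exact two_equal i j k hij hik hjk h₁
  by_cases h₂ : g j = g k
  · exact (two_equal j k i hjk hij.symm hik.symm h₂).mono fun ε hε => hε.rotate.rotate
  by_cases h₃ : g i = g k
  · exact (two_equal k i j hik.symm hjk.symm hij h₃.symm).mono fun ε hε => hε.rotate
  rcases fin_three_cases (g i) (g j) with hj | hj | hj
  · exact absurd hj.symm h₁
  · refine all_distinct i j k hj ?_
    rcases fin_three_cases (g i) (g k) with hk | hk | hk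
    · exact absurd hk.symm h₃
    · exact absurd (hj.trans hk.symm) h₂
    · exact hk
  · refine (all_distinct i k j ?_ hj).mono fun ε hε => hε.rotate.rotate.exchange
    rcases fin_three_cases (g i) (g k) with hk | hk | hk
    · exact absurd hk.symm h₃
    · exact hk
    · exact absurd (hj.trans hk.symm) h₂

lemma sameRadial (h : ConeDecomposition P T g)
    (hPQ : ∀ i j k, i ≠ j → i ≠ k → j ≠ k → FlipsTransversal P Q g i j k) : SameRadial P Q := by
  have key : ∀ i j k, i ≠ j → i ≠ k → j ≠ k →
      (Transversal g i j k → (0 < area (Q i) (Q j) (Q k) ↔ ¬ 0 < area (P i) (P j) (P k))) ∧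
      (¬ Transversal g i j k → (0 < area (Q i) (Q j) (Q k) ↔ 0 < area (P i) (P j) (P k))) := by
    intro i j k hij hik hjk
    obtain ⟨h₁, h₂⟩ := hPQ i j k hij hik hjk
    refine ⟨fun ht => ?_, fun ht => (pos_iff_pos_of_mul_pos (h₂ ht)).symm⟩
    have := h₁ ht
    constructor
    · intro hQ hP
      exact this.not_gt (mul_pos hP hQ)
    · intro hP
      by_contra hQ
      exact this.not_ge (mul_nonneg_of_nonpos_of_nonpos (not_lt.1 hP) (not_lt.1 hQ))
  have one : ∀ i j k l, i ≠ j → g i = g j → Transversal g i k l →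
      (0 < area (P i) (P j) (P k) ↔ 0 < area (P i) (P l) (P j)) := by
    intro i j k l hij hg ht
    rw [area_swap (P i) (P j) (P l)]
    rcases ht.cases with ⟨hk, hl⟩ | ⟨hl, hk⟩
    · have h₁ := h.area_succ hij hg hk
      have h₂ := h.area_pred hij hg hl
      rw [← neg_pos, ← mul_neg] at h₂
      rw [← pos_iff_pos_of_mul_pos h₁, pos_iff_pos_of_mul_pos h₂]
    · have h₁ := h.area_pred hij hg hk
      have h₂ := h.area_succ hij hg hl
      rw [← neg_pos, ← neg_mul] at h₁
      rw [← neg_mul_neg] at h₂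
      rw [← pos_iff_pos_of_mul_pos h₁, pos_iff_pos_of_mul_pos h₂]
  have two : ∀ i j k l, g j = g k → Transversal g i k l →
      (0 < area (P i) (P k) (P l) ↔ ¬ 0 < area (P i) (P l) (P j)) := by
    intro i j k l hg ht
    rcases ht.cases with ⟨hk, hl⟩ | ⟨hl, hk⟩
    · have h₁ := h.area_transversal hk hl
      have h₂ := h.area_transversal (hg.trans hk) hl
      rw [area_swap (P i) (P j) (P l)]
      exact iff_of_true h₁ (by linarith)
    · have h₁ := h.area_transversal hl hk
      have h₂ := h.area_transversal hl (hg.trans hk)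
      rw [area_swap (P i) (P l) (P k)]
      exact iff_of_false (by linarith) (not_not.2 h₂)
  rintro i j k l ⟨hij, hik, hil, hjk, hjl, hkl⟩
  have k₁ := key i j k hij hik hjk
  have k₂ := key i k l hik hil hkl
  have k₃ := key i l j hil hij hjl.symm
  rw [ccw_iff, ccw_iff]
  by_cases t₁ : Transversal g i j k <;> by_cases t₂ : Transversal g i k l <;>
    by_cases t₃ : Transversal g i l j <;>
    simp only [t₁, t₂, t₃, true_imp_iff, false_imp_iff, not_true, not_false_eq_true, and_true,
      true_and] at k₁ k₂ k₃ <;> rw [k₁, k₂, k₃]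
  · exact absurd t₃ ((fin_three_eq_of_ne _ _ _ _ t₁).1 t₂).1
  · have := two i l j k ((fin_three_eq_of_ne _ _ _ _ t₁).1 t₂).2 t₁
    tauto
  · have := two i k l j (((fin_three_eq_of_ne _ _ _ _ t₁).2 t₂).1 t₃) t₃
    tauto
  · have := one i l j k hil (((fin_three_eq_of_ne _ _ _ _ t₁).2 t₂).2 t₃) t₁
    tauto
  · have := two i j k l ((fin_three_eq_of_ne _ _ _ _ t₂).1 t₃).2 t₂
    tauto
  · have := one i j k l hij (((fin_three_eq_of_ne _ _ _ _ t₂).2 t₃).2 t₁) t₂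
    tauto
  · have := one i k l j hik (((fin_three_eq_of_ne _ _ _ _ t₃).2 t₁).2 t₂) t₃
    tauto

end ConeDecomposition

end

lemma ConeDecomposition.exists_realization {n : ℕ} (hn : 3 ≤ n) {P : Fin n → ℝ × ℝ}
    {T : Fin 3 → Fin n} {g : Fin n → Fin 3} (h : ConeDecomposition P T g) (hP : GenPos P)
    (hT : ∀ t, g (T t) = t) :
    ∃ Q : Fin n → ℝ × ℝ, Function.Injective Q ∧ GenPos Q ∧ SameRadial P Q ∧
      ExtremeSet Q = {T 0, T 1, T 2} := by
  obtain ⟨M, hM⟩ : ∃ M, ∀ x, depth P T g x < M := by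
    obtain ⟨M, hM⟩ := (Set.finite_range (depth P T g)).bddAbove
    exact ⟨M + 1, fun x => by linarith [hM ⟨x, rfl⟩]⟩
  obtain ⟨ε, hε⟩ : ∃ ε : ℝ, ∀ i j k, i ≠ j → i ≠ k → j ≠ k →
      FlipsTransversal P (inversion P T g M ε) g i j k := by
    refine Filter.Eventually.exists (f := nhdsWithin (0 : ℝ) (Set.Ioi 0)) ?_
    refine Filter.eventually_all.2 fun i => Filter.eventually_all.2 fun j =>
      Filter.eventually_all.2 fun k => ?_
    by_cases hne : i ≠ j ∧ i ≠ k ∧ j ≠ k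
    · exact (h.eventually_flipsTransversal hP hM hne.1 hne.2.1 hne.2.2).mono
        fun ε hε _ _ _ => hε
    · exact Filter.Eventually.of_forall fun ε h₁ h₂ h₃ => absurd ⟨h₁, h₂, h₃⟩ hne
  set Q := inversion P T g M ε
  have hQ : GenPos Q := by
    rw [genPos_iff]
    intro i j k hij hik hjk h0
    obtain ⟨h₁, h₂⟩ := hε i j k hij hik hjk
    rw [h0, mul_zero] at h₁ h₂
    by_cases ht : Transversal g i j k
    · exact lt_irrefl _ (h₁ ht)
    · exact lt_irrefl _ (h₂ ht)
  have hTne : ∀ s t, s ≠ t → T s ≠ T t := fun s t hst he => hst (by rw [← hT s, he, hT])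
  have hside : ∀ u x, (∀ t, x ≠ T t) → area (Q (T u)) (Q (T (u + 1))) (Q x) < 0 := by
    intro u x hx
    have hu := hTne u (u + 1) (fin_three_ne u).1
    obtain ⟨h₁, h₂⟩ := hε (T u) (T (u + 1)) x hu (hx _).symm (hx _).symm
    have hne := (genPos_iff P).1 hP (T u) (T (u + 1)) x hu (hx _).symm (hx _).symm
    rcases fin_three_cases u (g x) with hg | hg | hg
    · have hnt : ¬ Transversal g (T u) (T (u + 1)) x := fun ht => ht.2.2 (by rw [hT, hg])
      have hr := h.right x
      rw [hg] at hr
      exact (neg_iff_neg_of_mul_pos (h₂ hnt)).1 (lt_of_le_of_ne hr hne)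
    · have hnt : ¬ Transversal g (T u) (T (u + 1)) x := fun ht => ht.2.1 (by rw [hT, hg])
      have hl := h.left x
      rw [hg, (fin_three_add_add u).2.1] at hl
      exact (neg_iff_neg_of_mul_pos (h₂ hnt)).1 (lt_of_le_of_ne hl hne)
    · have ht : Transversal g (T u) (T (u + 1)) x := by
        obtain ⟨e₁, e₂, e₃⟩ := fin_three_ne u
        simp only [Transversal, hT, hg]
        exact ⟨e₁, e₃, e₂⟩
      have hpos := h.area_transversal (i := T u) (j := T (u + 1)) (k := x) (by simp only [hT])
        (by rw [hg, hT])
      exact neg_of_mul_neg_right (h₁ ht) hpos.le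
  have horient : area (Q (T 0)) (Q (T 1)) (Q (T 2)) < 0 := by
    have ht : Transversal g (T 0) (T 1) (T 2) := by
      simp only [Transversal, hT]; decide
    exact neg_of_mul_neg_right ((hε _ _ _ (hTne 0 1 (by decide)) (hTne 0 2 (by decide))
      (hTne 1 2 (by decide))).1 ht) (h.pos 0).le
  refine ⟨Q, hQ.injective hn, hQ, h.sameRadial hε, extremeSet_eq_of_area_mul_pos
    (hTne 0 1 (by decide)) (hTne 0 2 (by decide)) (hTne 1 2 (by decide)) horient.ne ?_⟩
  intro x h₀ h₁ h₂
  have hx : ∀ t, x ≠ T t := by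
    intro t; fin_cases t
    exacts [h₀, h₁, h₂]
  exact ⟨mul_pos_of_neg_of_neg horient (hside 1 x hx),
    mul_pos_of_neg_of_neg horient (hside 2 x hx), mul_pos_of_neg_of_neg horient (hside 0 x hx)⟩

lemma exists_coneDecomposition {α : Type*} {P : α → ℝ × ℝ} (hP : GenPos P) {T : Fin 3 → α}
    (hT : Function.Injective T)
    (hpos : ∀ t, 0 < area (P (T t)) (P (T (t + 1))) (P (T (t + 2))))
    (hcone : ∀ x, (∀ s, x ≠ T s) → ∃ t, area (P (T t)) (P (T (t + 1))) (P x) < 0 ∧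
      area (P (T (t + 2))) (P (T t)) (P x) < 0)
    (hline : ∀ t v w, v ≠ w →
      area (P (T t)) (P (T (t + 1))) (P v) < 0 ∧ area (P (T (t + 2))) (P (T t)) (P v) < 0 →
      area (P (T t)) (P (T (t + 1))) (P w) < 0 ∧ area (P (T (t + 2))) (P (T t)) (P w) < 0 →
      (lineThrough (P v) (P w) ∩ segment ℝ (P (T (t + 1))) (P (T (t + 2)))).Nonempty) :
    ∃ g, ConeDecomposition P T g ∧ ∀ t, g (T t) = t := by
  have hex : ∀ x, ∃ t, x = T t ∨ (∀ s, x ≠ T s) ∧ area (P (T t)) (P (T (t + 1))) (P x) < 0 ∧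
      area (P (T (t + 2))) (P (T t)) (P x) < 0 := by
    intro x
    by_cases hx : ∃ s, x = T s
    · exact hx.imp fun s hs => Or.inl hs
    · push Not at hx
      exact (hcone x hx).imp fun t ht => Or.inr ⟨hx, ht⟩
  choose g hg using hex
  refine ⟨g, ⟨hpos, fun x => ?_, fun x => ?_, fun i j hij hgij => ?_⟩, fun t => ?_⟩
  · rcases hg x with hx | ⟨-, hx, -⟩
    · exact (congrArg (fun y => area (P (T (g x))) (P (T (g x + 1))) (P y)) hx).trans_le
        (area_left_self _ _).le
    · exact hx.le
  · rcases hg x with hx | ⟨-, -, hx⟩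
    · exact (congrArg (fun y => area (P (T (g x + 2))) (P (T (g x))) (P y)) hx).trans_le
        (area_right_self _ _).le
    · exact hx.le
  · have hi := hg i
    have hj := hg j
    rw [← hgij] at hj
    generalize g i = t at hi hj
    rcases hi with rfl | ⟨hi, hi'⟩ <;> rcases hj with rfl | ⟨hj, hj'⟩
    · exact absurd rfl hij
    · rw [area_swap, area_rotate (P (T (t + 2)))]
      exact mul_neg_of_pos_of_neg (neg_pos.2 hj'.1) hj'.2
    · rw [area_swap _ (P (T (t + 2))), ← area_rotate (P i), ← area_rotate (P i)]
      exact mul_neg_of_neg_of_pos hi'.1 (neg_pos.2 hi'.2)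
    · refine lt_of_le_of_ne (area_mul_nonpos_of_lineThrough_inter_segment
        (hline t i j hij hi' hj')) (mul_ne_zero ?_ ?_)
      · exact (genPos_iff P).1 hP _ _ _ hij (hi _) (hj _)
      · exact (genPos_iff P).1 hP _ _ _ hij (hi _) (hj _)
  · rcases hg (T t) with h | ⟨h, -⟩
    · exact (hT h).symm
    · exact absurd rfl (h t)

lemma lineThrough_inter_segment_of_sameRadial {α : Type*} {P Q : α → ℝ × ℝ} (hP : GenPos P)
    (hPQ : SameRadial P Q) {a b c v w : α} (hbc : b ≠ c) (hD : 0 < area (P a) (P b) (P c))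
    (hQ : ∀ x, x ≠ a → x ≠ b → x ≠ c → area (Q b) (Q c) (Q x) < 0) (hvw : v ≠ w)
    (hv : area (P a) (P b) (P v) < 0 ∧ area (P c) (P a) (P v) < 0)
    (hw : area (P a) (P b) (P w) < 0 ∧ area (P c) (P a) (P w) < 0) :
    (lineThrough (P v) (P w) ∩ segment ℝ (P b) (P c)).Nonempty := by
  have key : ∀ x, area (P a) (P b) (P x) < 0 ∧ area (P c) (P a) (P x) < 0 →
      x ≠ a ∧ x ≠ b ∧ x ≠ c ∧ 0 < area (P b) (P c) (P x) := by
    rintro x ⟨h₁, h₂⟩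
    refine ⟨?_, ?_, ?_, by linarith [area_add (P a) (P b) (P c) (P x)]⟩
    · rintro rfl
      exact h₁.ne (area_left_self _ _)
    · rintro rfl
      exact h₁.ne (area_right_self _ _)
    · rintro rfl
      exact h₂.ne (area_left_self _ _)
  obtain ⟨va, vb, vc, hv'⟩ := key v hv
  obtain ⟨wa, wb, wc, hw'⟩ := key w hw
  exact lineThrough_inter_segment_nonempty (area_mul_neg_of_sameRadial hP hPQ hbc vb.symm wb.symm
    vc.symm wc.symm hvw hv' hw' (hQ v va vb vc) (hQ w wa wb wc))

/-- characterization of inner important triangles. -/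
theorem inner_important_triangle_iff {n : ℕ} (hn : 5 ≤ n)
    (P : Fin n → ℝ × ℝ)
    (hinj : Function.Injective P) (hgp : GenPos P)
    (a b c : Fin n) (hab : a ≠ b) (hac : a ≠ c) (hbc : b ≠ c)
    (habc : chi P a b c = 1) :
    (Important P {a, b, c} ∧ ExtremeSet P ≠ {a, b, c}) ↔
      ((∀ x : Fin n, x ≠ a → x ≠ b → x ≠ c →
          P x ∉ convexHull ℝ ({P a, P b, P c} : Set (ℝ × ℝ))) ∧
       (∀ x : Fin n, x ≠ a → x ≠ b → x ≠ c →
          ((chi P b a x = 1 ∧ chi P c a x = -1) ∧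
             ¬ (chi P c b x = 1 ∧ chi P a b x = -1) ∧
             ¬ (chi P a c x = 1 ∧ chi P b c x = -1)) ∨
          (¬ (chi P b a x = 1 ∧ chi P c a x = -1) ∧
             (chi P c b x = 1 ∧ chi P a b x = -1) ∧
             ¬ (chi P a c x = 1 ∧ chi P b c x = -1)) ∨
          (¬ (chi P b a x = 1 ∧ chi P c a x = -1) ∧
             ¬ (chi P c b x = 1 ∧ chi P a b x = -1) ∧
             (chi P a c x = 1 ∧ chi P b c x = -1))) ∧
       (∀ v w : Fin n, v ≠ w →
          ((chi P b a v = 1 ∧ chi P c a v = -1) →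
           (chi P b a w = 1 ∧ chi P c a w = -1) →
            (lineThrough (P v) (P w) ∩ segment ℝ (P b) (P c)).Nonempty) ∧
          ((chi P c b v = 1 ∧ chi P a b v = -1) →
           (chi P c b w = 1 ∧ chi P a b w = -1) →
            (lineThrough (P v) (P w) ∩ segment ℝ (P c) (P a)).Nonempty) ∧
          ((chi P a c v = 1 ∧ chi P b c v = -1) →
           (chi P a c w = 1 ∧ chi P b c w = -1) →
            (lineThrough (P v) (P w) ∩ segment ℝ (P a) (P b)).Nonempty))) := by
  have hcone : ∀ p q r x : Fin n, (chi P q p x = 1 ∧ chi P r p x = -1) ↔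
      (area (P p) (P q) (P x) < 0 ∧ area (P r) (P p) (P x) < 0) := fun p q r x => by
    rw [chi_eq_one_iff, chi_eq_neg_one_iff, area_exchange, neg_pos]
  rw [chi_eq_one_iff] at habc
  simp only [hcone a b c, hcone b c a, hcone c a b]
  constructor
  · rintro ⟨⟨Q, hQi, hQ, hPQ, hQe⟩, hPe⟩
    have hin := fun x hxa hxb hxc =>
      area_mul_pos_of_extremeSet_eq hQi hQ hab hac hbc hQe (x := x) hxa hxb hxc
    have hor := fun x hxa hxb hxc =>
      orientations_of_sameRadial hgp hPQ hab hac hbc hxa hxb hxc habc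
        (hin x hxa hxb hxc).1 (hin x hxa hxb hxc).2.1 (hin x hxa hxb hxc).2.2
    have hneg : area (Q a) (Q b) (Q c) < 0 := by
      refine ((genPos_iff Q).1 hQ a b c hab hac hbc).lt_or_gt.resolve_right fun hpos => hPe ?_
      refine extremeSet_eq_of_area_mul_pos hab hac hbc habc.ne' fun x hxa hxb hxc => ?_
      obtain ⟨h₁, h₂, h₃⟩ := (hor x hxa hxb hxc).1 hpos
      exact ⟨mul_pos habc h₁, mul_pos habc h₂, mul_pos habc h₃⟩
    have hsign := fun x hxa hxb hxc => (hor x hxa hxb hxc).2 hneg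
    have hQneg : ∀ x, x ≠ a → x ≠ b → x ≠ c → area (Q b) (Q c) (Q x) < 0 ∧
        area (Q c) (Q a) (Q x) < 0 ∧ area (Q a) (Q b) (Q x) < 0 := fun x hxa hxb hxc =>
      ⟨(neg_iff_neg_of_mul_pos (hin x hxa hxb hxc).1).1 hneg,
        (neg_iff_neg_of_mul_pos (hin x hxa hxb hxc).2.1).1 hneg,
        (neg_iff_neg_of_mul_pos (hin x hxa hxb hxc).2.2).1 hneg⟩
    have hD₁ : 0 < area (P b) (P c) (P a) := by rwa [area_rotate]
    have hD₂ : 0 < area (P c) (P a) (P b) := by rwa [area_rotate, area_rotate]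
    refine ⟨fun x hxa hxb hxc hmem => ?_, fun x hxa hxb hxc => ?_, fun v w hvw =>
      ⟨fun hv hw => ?_, fun hv hw => ?_, fun hv hw => ?_⟩⟩
    · obtain ⟨u, v, w, hu, hv, hw, h₁, h₂, h₃⟩ := mem_convexHull_triple hmem
      have h₁ := h₁.symm ▸ mul_nonneg hu habc.le
      have h₂ := h₂.symm ▸ mul_nonneg hv habc.le
      have h₃ := h₃.symm ▸ mul_nonneg hw habc.le
      rcases hsign x hxa hxb hxc with h | h | h <;> linarith
    · rcases hsign x hxa hxb hxc with ⟨h₁, h₂, h₃⟩ | ⟨h₁, h₂, h₃⟩ | ⟨h₁, h₂, h₃⟩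
      · exact Or.inl ⟨⟨h₃, h₂⟩, fun h => h₁.not_gt h.1, fun h => h₁.not_gt h.2⟩
      · exact Or.inr (Or.inl ⟨fun h => h₂.not_gt h.2, ⟨h₁, h₃⟩, fun h => h₂.not_gt h.1⟩)
      · exact Or.inr (Or.inr ⟨fun h => h₃.not_gt h.1, fun h => h₃.not_gt h.2, ⟨h₂, h₁⟩⟩)
    · exact lineThrough_inter_segment_of_sameRadial hgp hPQ hbc habc
        (fun x h₁ h₂ h₃ => (hQneg x h₁ h₂ h₃).1) hvw hv hw
    · exact lineThrough_inter_segment_of_sameRadial hgp hPQ hac.symm hD₁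
        (fun x h₁ h₂ h₃ => (hQneg x h₃ h₁ h₂).2.1) hvw hv hw
    · exact lineThrough_inter_segment_of_sameRadial hgp hPQ hab hD₂
        (fun x h₁ h₂ h₃ => (hQneg x h₂ h₃ h₁).2.2) hvw hv hw
  · rintro ⟨hout, hpart, hline⟩
    constructor
    · have hT : Function.Injective ![a, b, c] := by
        intro s t hst
        fin_cases s <;> fin_cases t <;> simp_all
      obtain ⟨g, hg, hgT⟩ := exists_coneDecomposition hgp hT
        (fun t => by
          fin_cases t
          · exact habc
          · exact (area_rotate _ _ _).symm ▸ habc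
          · exact (area_rotate (P b) _ _).symm ▸ (area_rotate _ _ _).symm ▸ habc)
        (fun x hx => by
          rcases hpart x (hx 0) (hx 1) (hx 2) with h | h | h
          · exact ⟨0, h.1⟩
          · exact ⟨1, h.2.1⟩
          · exact ⟨2, h.2.2⟩)
        (fun t v w hvw hv hw => by
          fin_cases t
          · exact (hline v w hvw).1 hv hw
          · exact (hline v w hvw).2.1 hv hw
          · exact (hline v w hvw).2.2 hv hw)
      exact hg.exists_realization (by omega) hgp hgT
    · intro hext
      obtain ⟨x, hx⟩ : ∃ x, x ∉ ({a, b, c} : Finset (Fin n)) := by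
        by_contra! hall
        have h₁ : (Finset.univ : Finset (Fin n)).card ≤ ({a, b, c} : Finset (Fin n)).card :=
          Finset.card_le_card fun x _ => hall x
        have h₂ := Finset.card_le_three (a := a) (b := b) (c := c)
        simp at h₁
        omega
      simp only [Finset.mem_insert, Finset.mem_singleton, not_or] at hx
      have hmem := range_subset_convexHull_extremeSet hinj x
      rw [hext, Set.image_insert_eq, Set.image_pair] at hmem
      exact hout x hx.1 hx.2.1 hx.2.2 hmem
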